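/- arXiv:1605.01064 — 6 statements merged into one kernel-verified Lean document; each statement's English description precedes it below -/
import Mathlib

section
/- Let the Stage II resource theory have a currency (𝒞, Val, Ω) for a target 𝒮, independent of the target and good for the rich. Let V, W ∈ 𝒮 and C, C' ∈ 𝒞 with Val C ≤ Val C'. Assume the set {Val C₂ − Val C : C₂ ∈ 𝒞 ∧ V ∩ C → W ∩ C₂} is nonempty, the set {Val C₂ − Val C' : C₂ ∈ 𝒞 ∧ V ∩ C' → W ∩ C₂} is bounded above, and for every C₂ ∈ 𝒞 with V ∩ C → W ∩ C₂ (setting Δ := Val C₂ − Val C) one has Val C' ≥ −Δ and Val C' + Δ < c_sup. Then Balance(V→W|C) ≤ Balance(V→W|C'). -/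
/-- The cost of a resource `V`: the infimum of values of currency resources that can
produce `V`. -/
noncomputable def RTCost {X : Type*} (arrow : Set X → Set X → Prop) (𝒞 : Set (Set X))
    (Val : Set X → ℝ) (V : Set X) : ℝ :=
  sInf {x : ℝ | ∃ C ∈ 𝒞, arrow C V ∧ Val C = x}

/-- The yield of a resource `V`: the supremum of values of currency resources that
can be extracted from `V`. -/
noncomputable def RTYield {X : Type*} (arrow : Set X → Set X → Prop) (𝒞 : Set (Set X))
    (Val : Set X → ℝ) (V : Set X) : ℝ :=
  sSup {x : ℝ | ∃ C ∈ 𝒞, arrow V C ∧ Val C = x}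

/-- `Balance(V→W|C)`: the supremum of `Val C' − Val C` over currency resources `C'`
such that `V ∩ C → W ∩ C'`. -/
noncomputable def RTBalance {X : Type*} (arrow : Set X → Set X → Prop) (𝒞 : Set (Set X))
    (Val : Set X → ℝ) (V W C : Set X) : ℝ :=
  sSup {x : ℝ | ∃ C' ∈ 𝒞, arrow (V ∩ C) (W ∩ C') ∧ Val C' - Val C = x}

/-- `c_sup`: the supremum of the values of currency resources, taken in `[0,∞]`
(formalized in the extended reals). -/
noncomputable def RTcsup {X : Type*} (𝒞 : Set (Set X)) (Val : Set X → ℝ) : EReal :=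
  sSup {x : EReal | ∃ C ∈ 𝒞, (Val C : EReal) = x}

/-- The currency is *good for the rich*: whenever `V ∩ C₁ → W ∩ C₂` with
`Δ := Val C₂ − Val C₁`, the same value difference `Δ` can be realized starting from
any currency resource of value at least `Val C₁` (within suitable bounds), and
symmetrically for the final currency resource. -/
def GoodForRich {X : Type*} (arrow : Set X → Set X → Prop) (𝒞 𝒮 : Set (Set X))
    (Val : Set X → ℝ) : Prop :=
  ∀ C₁ ∈ 𝒞, ∀ C₂ ∈ 𝒞, ∀ V ∈ 𝒮, ∀ W ∈ 𝒮, arrow (V ∩ C₁) (W ∩ C₂) →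
    (∀ C₁' ∈ 𝒞, Val C₁ ≤ Val C₁' → -(Val C₂ - Val C₁) ≤ Val C₁' →
      ((Val C₁' + (Val C₂ - Val C₁) : ℝ) : EReal) < RTcsup 𝒞 Val →
      ∃ C₂' ∈ 𝒞, Val C₂' = Val C₁' + (Val C₂ - Val C₁) ∧ arrow (V ∩ C₁') (W ∩ C₂')) ∧
    (∀ C₂' ∈ 𝒞, Val C₂ ≤ Val C₂' → Val C₂ - Val C₁ ≤ Val C₂' →
      ∃ C₁' ∈ 𝒞, Val C₂' = Val C₁' + (Val C₂ - Val C₁) ∧ arrow (V ∩ C₁') (W ∩ C₂'))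

/-- The currency is *good for the poor*: whenever `V ∩ C₁ → W ∩ C₂` with
`Δ := Val C₂ − Val C₁`, the same value difference `Δ` can be realized starting from
any currency resource of value at most `Val C₁` (within suitable bounds), and
symmetrically for the final currency resource. -/
def GoodForPoor {X : Type*} (arrow : Set X → Set X → Prop) (𝒞 𝒮 : Set (Set X))
    (Val : Set X → ℝ) : Prop :=
  ∀ C₁ ∈ 𝒞, ∀ C₂ ∈ 𝒞, ∀ V ∈ 𝒮, ∀ W ∈ 𝒮, arrow (V ∩ C₁) (W ∩ C₂) →
    (∀ C₁' ∈ 𝒞, Val C₁' ≤ Val C₁ → -(Val C₂ - Val C₁) ≤ Val C₁' →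
      ((Val C₁' + (Val C₂ - Val C₁) : ℝ) : EReal) < RTcsup 𝒞 Val →
      ∃ C₂' ∈ 𝒞, Val C₂' = Val C₁' + (Val C₂ - Val C₁) ∧ arrow (V ∩ C₁') (W ∩ C₂')) ∧
    (∀ C₂' ∈ 𝒞, Val C₂' ≤ Val C₂ → Val C₂ - Val C₁ ≤ Val C₂' →
      ∃ C₁' ∈ 𝒞, Val C₂' = Val C₁' + (Val C₂ - Val C₁) ∧ arrow (V ∩ C₁') (W ∩ C₂'))

/-- The currency is *fair*: whenever `V ∩ C₁ → W ∩ C₂` with `Δ := Val C₂ − Val C₁`,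
the same value difference `Δ` can be realized starting from any currency resource
(within suitable bounds), and symmetrically for the final currency resource. -/
def FairCurrency {X : Type*} (arrow : Set X → Set X → Prop) (𝒞 𝒮 : Set (Set X))
    (Val : Set X → ℝ) : Prop :=
  ∀ C₁ ∈ 𝒞, ∀ C₂ ∈ 𝒞, ∀ V ∈ 𝒮, ∀ W ∈ 𝒮, arrow (V ∩ C₁) (W ∩ C₂) →
    (∀ C₁' ∈ 𝒞, -(Val C₂ - Val C₁) ≤ Val C₁' →
      ((Val C₁' + (Val C₂ - Val C₁) : ℝ) : EReal) < RTcsup 𝒞 Val →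
      ∃ C₂' ∈ 𝒞, Val C₂' = Val C₁' + (Val C₂ - Val C₁) ∧ arrow (V ∩ C₁') (W ∩ C₂')) ∧
    (∀ C₂' ∈ 𝒞, Val C₂ - Val C₁ ≤ Val C₂' →
      ∃ C₁' ∈ 𝒞, Val C₂' = Val C₁' + (Val C₂ - Val C₁) ∧ arrow (V ∩ C₁') (W ∩ C₂'))

/-- For a currency independent of the target and good for the rich,
the balance is non-decreasing with the available currency: `Val C ≤ Val C'` implies
`Balance(V→W|C) ≤ Balance(V→W|C')` (within suitable bounds). -/
theorem stmt7 {X : Type*} [Nonempty X] (arrow : Set X → Set X → Prop)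
    (𝒞 𝒮 : Set (Set X)) (Val : Set X → ℝ)
    (hrefl : ∀ A, arrow A A)
    (htrans : ∀ A B C, arrow A B → arrow B C → arrow A C)
    (hincl : ∀ A B : Set X, A ⊆ B → arrow A B)
    (h𝒞ne : ∀ C ∈ 𝒞, C.Nonempty) (h𝒮ne : ∀ V ∈ 𝒮, V.Nonempty)
    (hΩC : (Set.univ : Set X) ∈ 𝒞) (hΩS : (Set.univ : Set X) ∈ 𝒮)
    (hVal_nonneg : ∀ C ∈ 𝒞, 0 ≤ Val C) (hValΩ : Val (Set.univ : Set X) = 0)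
    (horder : ∀ C ∈ 𝒞, ∀ C' ∈ 𝒞, (Val C' ≤ Val C ↔ arrow C C'))
    (huniv : ∀ V ∈ 𝒮, (∃ C ∈ 𝒞, arrow C V) ∧ (∃ C' ∈ 𝒞, arrow V C'))
    (hcompat : ∀ C ∈ 𝒞, ∀ V ∈ 𝒮, (C ∩ V).Nonempty)
    (hindep : ∀ C ∈ 𝒞, ∀ C' ∈ 𝒞, ∀ V ∈ 𝒮, arrow C C' → arrow (C ∩ V) (C' ∩ V))
    (hrich : GoodForRich arrow 𝒞 𝒮 Val)
    (V W : Set X) (hV : V ∈ 𝒮) (hW : W ∈ 𝒮)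
    (C C' : Set X) (hC : C ∈ 𝒞) (hC' : C' ∈ 𝒞) (hval : Val C ≤ Val C')
    (hne : {x : ℝ | ∃ C₂ ∈ 𝒞, arrow (V ∩ C) (W ∩ C₂) ∧ Val C₂ - Val C = x}.Nonempty)
    (hbdd : BddAbove {x : ℝ | ∃ C₂ ∈ 𝒞, arrow (V ∩ C') (W ∩ C₂) ∧ Val C₂ - Val C' = x})
    (hcond : ∀ C₂ ∈ 𝒞, arrow (V ∩ C) (W ∩ C₂) →
      -(Val C₂ - Val C) ≤ Val C' ∧
        ((Val C' + (Val C₂ - Val C) : ℝ) : EReal) < RTcsup 𝒞 Val) :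
    RTBalance arrow 𝒞 Val V W C ≤ RTBalance arrow 𝒞 Val V W C' := by
  refine csSup_le_csSup hbdd hne ?_
  rintro x ⟨C₂, hC₂, harrow, rfl⟩
  obtain ⟨hlow, hsup⟩ := hcond C₂ hC₂ harrow
  obtain ⟨C₂', hC₂', hVal, harrow'⟩ :=
    (hrich C hC C₂ hC₂ V hV W hW harrow).1 C' hC' hval hlow hsup
  exact ⟨C₂', hC₂', harrow', by linarith⟩
end

section
/- Let the Stage II resource theory have a fair currency (𝒞, Val, Ω) for a target 𝒮, independent of the target, and let V ∈ 𝒮 (with the relevant defining sets nonempty and bounded above/below as needed for the suprema and infima to be attained up to arbitrarily small error). Then Cost(V) = − sSup {Val C' − Val C : C, C' ∈ 𝒞 ∧ C → V ∩ C'} and Yield(V) = sSup {Val C' − Val C : C, C' ∈ 𝒞 ∧ V ∩ C → C'}. -/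
/-- For a fair currency independent of the target:
`Cost(V) = − sup {Val C' − Val C : C, C' ∈ 𝒞, C → V ∩ C'}` and
`Yield(V) = sup {Val C' − Val C : C, C' ∈ 𝒞, V ∩ C → C'}`. -/
theorem stmt10 {X : Type*} [Nonempty X] (arrow : Set X → Set X → Prop)
    (𝒞 𝒮 : Set (Set X)) (Val : Set X → ℝ)
    (hrefl : ∀ A, arrow A A)
    (htrans : ∀ A B C, arrow A B → arrow B C → arrow A C)
    (hincl : ∀ A B : Set X, A ⊆ B → arrow A B)
    (h𝒞ne : ∀ C ∈ 𝒞, C.Nonempty) (h𝒮ne : ∀ V ∈ 𝒮, V.Nonempty)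
    (hΩC : (Set.univ : Set X) ∈ 𝒞) (hΩS : (Set.univ : Set X) ∈ 𝒮)
    (hVal_nonneg : ∀ C ∈ 𝒞, 0 ≤ Val C) (hValΩ : Val (Set.univ : Set X) = 0)
    (horder : ∀ C ∈ 𝒞, ∀ C' ∈ 𝒞, (Val C' ≤ Val C ↔ arrow C C'))
    (huniv : ∀ V ∈ 𝒮, (∃ C ∈ 𝒞, arrow C V) ∧ (∃ C' ∈ 𝒞, arrow V C'))
    (hcompat : ∀ C ∈ 𝒞, ∀ V ∈ 𝒮, (C ∩ V).Nonempty)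
    (hindep : ∀ C ∈ 𝒞, ∀ C' ∈ 𝒞, ∀ V ∈ 𝒮, arrow C C' → arrow (C ∩ V) (C' ∩ V))
    (hfair : FairCurrency arrow 𝒞 𝒮 Val)
    (V : Set X) (hV : V ∈ 𝒮)
    (hbddY : BddAbove {x : ℝ | ∃ C ∈ 𝒞, arrow V C ∧ Val C = x})
    (hne₁ : {x : ℝ | ∃ C ∈ 𝒞, ∃ C' ∈ 𝒞, arrow C (V ∩ C') ∧ Val C' - Val C = x}.Nonempty)
    (hbdd₁ : BddAbove {x : ℝ | ∃ C ∈ 𝒞, ∃ C' ∈ 𝒞, arrow C (V ∩ C') ∧ Val C' - Val C = x})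
    (hne₂ : {x : ℝ | ∃ C ∈ 𝒞, ∃ C' ∈ 𝒞, arrow (V ∩ C) C' ∧ Val C' - Val C = x}.Nonempty)
    (hbdd₂ : BddAbove {x : ℝ | ∃ C ∈ 𝒞, ∃ C' ∈ 𝒞, arrow (V ∩ C) C' ∧ Val C' - Val C = x}) :
    RTCost arrow 𝒞 Val V =
        -sSup {x : ℝ | ∃ C ∈ 𝒞, ∃ C' ∈ 𝒞, arrow C (V ∩ C') ∧ Val C' - Val C = x} ∧
      RTYield arrow 𝒞 Val V =
        sSup {x : ℝ | ∃ C ∈ 𝒞, ∃ C' ∈ 𝒞, arrow (V ∩ C) C' ∧ Val C' - Val C = x} := by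
  constructor
  · unfold RTCost
    rw [← Real.sInf_neg]
    congr 1
    ext x
    simp only [Set.mem_neg, Set.mem_ofPred_eq]
    constructor
    · rintro ⟨C, hC, hCV, rfl⟩
      exact ⟨C, hC, Set.univ, hΩC, by rwa [Set.inter_univ], by rw [hValΩ, zero_sub]⟩
    · rintro ⟨C, hC, C', hC', hCV, hx⟩
      have hle : Val C' ≤ Val C :=
        (horder C hC C' hC').2 (htrans _ _ _ hCV (hincl _ _ Set.inter_subset_right))
      obtain ⟨D, hD, hDval, hDV⟩ :=
        (hfair C hC C' hC' Set.univ hΩS V hV (by rwa [Set.univ_inter])).2 Set.univ hΩC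
          (by rw [hValΩ]; linarith)
      rw [Set.univ_inter, Set.inter_univ] at hDV
      exact ⟨D, hD, hDV, by linarith⟩
  · unfold RTYield
    have hVΩ : arrow V Set.univ := hincl _ _ (Set.subset_univ V)
    apply le_antisymm
    · refine csSup_le_csSup hbdd₂ ⟨_, Set.univ, hΩC, hVΩ, rfl⟩ ?_
      rintro _ ⟨C, hC, hVC, rfl⟩
      exact ⟨Set.univ, hΩC, C, hC, by rwa [Set.inter_univ], by rw [hValΩ, sub_zero]⟩
    · refine csSup_le hne₂ ?_
      rintro _ ⟨C, hC, C', hC', hVC, rfl⟩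
      have hC_nonneg := hVal_nonneg C hC
      rcases lt_or_ge (Val C' - Val C) 0 with hneg | hnonneg
      · exact hneg.le.trans (le_csSup hbddY ⟨Set.univ, hΩC, hVΩ, hValΩ⟩)
      by_cases hsup : ((Val C' - Val C : ℝ) : EReal) < RTcsup 𝒞 Val
      · obtain ⟨D, hD, hDval, hVD⟩ :=
          (hfair C hC C' hC' V hV Set.univ hΩS (by rwa [Set.univ_inter])).1 Set.univ hΩC
            (by rw [hValΩ]; linarith) (by rwa [hValΩ, zero_add])
        rw [Set.univ_inter, Set.inter_univ] at hVD
        exact le_csSup hbddY ⟨D, hD, hVD, by rw [hDval, hValΩ, zero_add]⟩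
      · -- The difference attains `c_sup`, so `C` is free and `C'` can be extracted from `V` alone.
        have hC'_sup : (Val C' : EReal) ≤ RTcsup 𝒞 Val := le_sSup ⟨C', hC', rfl⟩
        have hle : Val C' ≤ Val C' - Val C :=
          EReal.coe_le_coe_iff.1 (hC'_sup.trans (not_lt.1 hsup))
        have hΩ_C : arrow Set.univ C :=
          (horder _ hΩC C hC).1 (by rw [hValΩ]; linarith)
        have hV_C : arrow V (V ∩ C) := by
          simpa only [Set.univ_inter, Set.inter_comm C V] using hindep _ hΩC C hC V hV hΩ_C
        exact (sub_le_self _ hC_nonneg).trans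
          (le_csSup hbddY ⟨C', hC', htrans _ _ _ hV_C hVC, rfl⟩)
end

section
/- Let the Stage II resource theory have a fair currency (𝒞, Val, Ω) for a target 𝒮, independent of the target, and let V, W ∈ 𝒮 (with the sets defining Yield(V), Cost(W), and the balances nonempty and bounded above as needed). Then for every ε > 0, sSup_{C ∈ 𝒞} Balance(V→W|C) ≥ Yield(V) − Cost(W) − ε. -/
/-- Every extraction `V → C₁` and every production `C₂ → W` combine, through a fair currency, into
a transformation `V ∩ C → W ∩ C'` gaining exactly `Val C₁ - Val C₂`. -/
theorem FairCurrency.exists_catalytic {X : Type*} {arrow : Set X → Set X → Prop}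
    {𝒞 𝒮 : Set (Set X)} {Val : Set X → ℝ}
    (hfair : FairCurrency arrow 𝒞 𝒮 Val)
    (htrans : ∀ A B C, arrow A B → arrow B C → arrow A C)
    (hΩC : (Set.univ : Set X) ∈ 𝒞) (hΩS : (Set.univ : Set X) ∈ 𝒮)
    (hVal_nonneg : ∀ C ∈ 𝒞, 0 ≤ Val C) (hValΩ : Val (Set.univ : Set X) = 0)
    (horder : ∀ C ∈ 𝒞, ∀ C' ∈ 𝒞, (Val C' ≤ Val C ↔ arrow C C'))
    {V W C₁ C₂ : Set X} (hV : V ∈ 𝒮) (hW : W ∈ 𝒮) (hC₁ : C₁ ∈ 𝒞) (hC₂ : C₂ ∈ 𝒞)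
    (hVC : arrow V C₁) (hCW : arrow C₂ W) :
    ∃ C ∈ 𝒞, ∃ C' ∈ 𝒞, arrow (V ∩ C) (W ∩ C') ∧ Val C' - Val C = Val C₁ - Val C₂ := by
  obtain ⟨M, hM, hM₁, hM₂⟩ : ∃ M ∈ 𝒞, Val C₁ ≤ Val M ∧ Val C₂ ≤ Val M := by
    rcases le_total (Val C₁) (Val C₂) with h | h
    exacts [⟨C₂, hC₂, h, le_rfl⟩, ⟨C₁, hC₁, le_rfl, h⟩]
  obtain ⟨C, hC, hCval, hCM⟩ := (hfair _ hΩC _ hC₁ V hV _ hΩS (by simpa using hVC)).2 M hM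
    (by linarith)
  obtain ⟨C', hC', hC'val, hMC'⟩ :
      ∃ C' ∈ 𝒞, Val C' = Val M - Val C₂ ∧ arrow M (W ∩ C') := by
    have key := hfair _ hC₂ _ hΩC _ hΩS W hW (by simpa using hCW)
    rcases (hVal_nonneg C₂ hC₂).eq_or_lt with h0 | hpos
    · obtain ⟨D, hD, hDval, hDM⟩ := key.2 M hM (by linarith [hVal_nonneg M hM])
      refine ⟨M, hM, by linarith, htrans _ D _ ?_ (by simpa using hDM)⟩
      exact (horder M hM D hD).1 (by linarith)
    · have hlt : ((Val M + (Val Set.univ - Val C₂) : ℝ) : EReal) < RTcsup 𝒞 Val :=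
        (EReal.coe_lt_coe_iff.2 (by linarith)).trans_le (le_sSup ⟨M, hM, rfl⟩)
      obtain ⟨D, hD, hDval, hDM⟩ := key.1 M hM (by linarith) hlt
      exact ⟨D, hD, by linarith, by simpa using hDM⟩
  exact ⟨C, hC, C', hC', htrans _ M _ (by simpa using hCM) hMC', by linarith⟩

/-- For a fair currency independent of the target, for every `ε > 0`,
`sup_{C ∈ 𝒞} Balance(V→W|C) ≥ Yield(V) − Cost(W) − ε`. -/
theorem stmt11 {X : Type*} [Nonempty X] (arrow : Set X → Set X → Prop)
    (𝒞 𝒮 : Set (Set X)) (Val : Set X → ℝ)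
    (hrefl : ∀ A, arrow A A)
    (htrans : ∀ A B C, arrow A B → arrow B C → arrow A C)
    (hincl : ∀ A B : Set X, A ⊆ B → arrow A B)
    (h𝒞ne : ∀ C ∈ 𝒞, C.Nonempty) (h𝒮ne : ∀ V ∈ 𝒮, V.Nonempty)
    (hΩC : (Set.univ : Set X) ∈ 𝒞) (hΩS : (Set.univ : Set X) ∈ 𝒮)
    (hVal_nonneg : ∀ C ∈ 𝒞, 0 ≤ Val C) (hValΩ : Val (Set.univ : Set X) = 0)
    (horder : ∀ C ∈ 𝒞, ∀ C' ∈ 𝒞, (Val C' ≤ Val C ↔ arrow C C'))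
    (huniv : ∀ V ∈ 𝒮, (∃ C ∈ 𝒞, arrow C V) ∧ (∃ C' ∈ 𝒞, arrow V C'))
    (hcompat : ∀ C ∈ 𝒞, ∀ V ∈ 𝒮, (C ∩ V).Nonempty)
    (hindep : ∀ C ∈ 𝒞, ∀ C' ∈ 𝒞, ∀ V ∈ 𝒮, arrow C C' → arrow (C ∩ V) (C' ∩ V))
    (hfair : FairCurrency arrow 𝒞 𝒮 Val)
    (V W : Set X) (hV : V ∈ 𝒮) (hW : W ∈ 𝒮)
    (hbddY : BddAbove {x : ℝ | ∃ C ∈ 𝒞, arrow V C ∧ Val C = x})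
    (hbalne : ∀ C ∈ 𝒞,
      {x : ℝ | ∃ C' ∈ 𝒞, arrow (V ∩ C) (W ∩ C') ∧ Val C' - Val C = x}.Nonempty)
    (hbalbdd : ∀ C ∈ 𝒞,
      BddAbove {x : ℝ | ∃ C' ∈ 𝒞, arrow (V ∩ C) (W ∩ C') ∧ Val C' - Val C = x})
    (hsupbdd : BddAbove {x : ℝ | ∃ C ∈ 𝒞, RTBalance arrow 𝒞 Val V W C = x}) :
    ∀ ε : ℝ, 0 < ε →
      RTYield arrow 𝒞 Val V - RTCost arrow 𝒞 Val W - ε ≤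
        sSup {x : ℝ | ∃ C ∈ 𝒞, RTBalance arrow 𝒞 Val V W C = x} := by
  intro ε hε
  set S := sSup {x : ℝ | ∃ C ∈ 𝒞, RTBalance arrow 𝒞 Val V W C = x}
  have key : ∀ C₁ ∈ 𝒞, ∀ C₂ ∈ 𝒞, arrow V C₁ → arrow C₂ W → Val C₁ - Val C₂ ≤ S := by
    intro C₁ hC₁ C₂ hC₂ hVC hCW
    obtain ⟨C, hC, C', hC', harrow, hval⟩ := hfair.exists_catalytic htrans hΩC hΩS hVal_nonneg
      hValΩ horder hV hW hC₁ hC₂ hVC hCW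
    calc Val C₁ - Val C₂ ≤ RTBalance arrow 𝒞 Val V W C :=
          le_csSup (hbalbdd C hC) ⟨C', hC', harrow, hval⟩
      _ ≤ S := le_csSup hsupbdd ⟨C, hC, rfl⟩
  obtain ⟨-, C₁, hC₁, hVC⟩ := huniv V hV
  obtain ⟨⟨C₂, hC₂, hCW⟩, -⟩ := huniv W hW
  have hcost : RTYield arrow 𝒞 Val V - S ≤ RTCost arrow 𝒞 Val W := by
    refine le_csInf ⟨_, C₂, hC₂, hCW, rfl⟩ ?_
    rintro _ ⟨D₂, hD₂, hDW, rfl⟩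
    have hyield : RTYield arrow 𝒞 Val V ≤ S + Val D₂ := by
      refine csSup_le ⟨_, C₁, hC₁, hVC, rfl⟩ ?_
      rintro _ ⟨D₁, hD₁, hVD, rfl⟩
      linarith [key D₁ hD₁ D₂ hD₂ hVD hDW]
    linarith
  linarith
end

section
/- Let the Stage II resource theory have a fair currency (𝒞, Val, Ω) for a target 𝒮, independent of the target. Suppose the currency is tight for V, W ∈ 𝒮, i.e. there exist C_V, C_W ∈ 𝒞 with C_V → V, V → C_V, C_W → W and W → C_W (and the sets defining the balances are nonempty and bounded above). Then sSup_{C ∈ 𝒞} Balance(V→W|C) = Yield(V) − Cost(W) = Cost(V) − Cost(W). -/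
theorem RTYield_eq_of_equiv {X : Type*} {arrow : Set X → Set X → Prop} {𝒞 : Set (Set X)}
    {Val : Set X → ℝ} (htrans : ∀ A B C, arrow A B → arrow B C → arrow A C)
    (horder : ∀ C ∈ 𝒞, ∀ C' ∈ 𝒞, (Val C' ≤ Val C ↔ arrow C C'))
    {V C : Set X} (hC : C ∈ 𝒞) (hCV : arrow C V) (hVC : arrow V C) :
    RTYield arrow 𝒞 Val V = Val C := by
  refine IsGreatest.csSup_eq ⟨⟨C, hC, hVC, rfl⟩, ?_⟩
  rintro _ ⟨D, hD, hVD, rfl⟩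
  exact (horder C hC D hD).2 (htrans _ _ _ hCV hVD)

theorem RTCost_eq_of_equiv {X : Type*} {arrow : Set X → Set X → Prop} {𝒞 : Set (Set X)}
    {Val : Set X → ℝ} (htrans : ∀ A B C, arrow A B → arrow B C → arrow A C)
    (horder : ∀ C ∈ 𝒞, ∀ C' ∈ 𝒞, (Val C' ≤ Val C ↔ arrow C C'))
    {V C : Set X} (hC : C ∈ 𝒞) (hCV : arrow C V) (hVC : arrow V C) :
    RTCost arrow 𝒞 Val V = Val C := by
  refine IsLeast.csInf_eq ⟨⟨C, hC, hCV, rfl⟩, ?_⟩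
  rintro _ ⟨D, hD, hDV, rfl⟩
  exact (horder D hD C hC).2 (htrans _ _ _ hDV hVC)

/-- For a fair currency independent of the target which is tight for
`V` and `W`, `sup_{C ∈ 𝒞} Balance(V→W|C) = Yield(V) − Cost(W) = Cost(V) − Cost(W)`. -/
theorem stmt12 {X : Type*} [Nonempty X] (arrow : Set X → Set X → Prop)
    (𝒞 𝒮 : Set (Set X)) (Val : Set X → ℝ)
    (hrefl : ∀ A, arrow A A)
    (htrans : ∀ A B C, arrow A B → arrow B C → arrow A C)
    (hincl : ∀ A B : Set X, A ⊆ B → arrow A B)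
    (h𝒞ne : ∀ C ∈ 𝒞, C.Nonempty) (h𝒮ne : ∀ V ∈ 𝒮, V.Nonempty)
    (hΩC : (Set.univ : Set X) ∈ 𝒞) (hΩS : (Set.univ : Set X) ∈ 𝒮)
    (hVal_nonneg : ∀ C ∈ 𝒞, 0 ≤ Val C) (hValΩ : Val (Set.univ : Set X) = 0)
    (horder : ∀ C ∈ 𝒞, ∀ C' ∈ 𝒞, (Val C' ≤ Val C ↔ arrow C C'))
    (huniv : ∀ V ∈ 𝒮, (∃ C ∈ 𝒞, arrow C V) ∧ (∃ C' ∈ 𝒞, arrow V C'))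
    (hcompat : ∀ C ∈ 𝒞, ∀ V ∈ 𝒮, (C ∩ V).Nonempty)
    (hindep : ∀ C ∈ 𝒞, ∀ C' ∈ 𝒞, ∀ V ∈ 𝒮, arrow C C' → arrow (C ∩ V) (C' ∩ V))
    (hfair : FairCurrency arrow 𝒞 𝒮 Val)
    (V W : Set X) (hV : V ∈ 𝒮) (hW : W ∈ 𝒮)
    (htightV : ∃ C ∈ 𝒞, arrow C V ∧ arrow V C)
    (htightW : ∃ C ∈ 𝒞, arrow C W ∧ arrow W C)
    (hbddY : BddAbove {x : ℝ | ∃ C ∈ 𝒞, arrow V C ∧ Val C = x})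
    (hbalne : ∀ C ∈ 𝒞,
      {x : ℝ | ∃ C' ∈ 𝒞, arrow (V ∩ C) (W ∩ C') ∧ Val C' - Val C = x}.Nonempty)
    (hbalbdd : ∀ C ∈ 𝒞,
      BddAbove {x : ℝ | ∃ C' ∈ 𝒞, arrow (V ∩ C) (W ∩ C') ∧ Val C' - Val C = x})
    (hsupbdd : BddAbove {x : ℝ | ∃ C ∈ 𝒞, RTBalance arrow 𝒞 Val V W C = x}) :
    sSup {x : ℝ | ∃ C ∈ 𝒞, RTBalance arrow 𝒞 Val V W C = x} =
        RTYield arrow 𝒞 Val V - RTCost arrow 𝒞 Val W ∧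
      RTYield arrow 𝒞 Val V - RTCost arrow 𝒞 Val W =
        RTCost arrow 𝒞 Val V - RTCost arrow 𝒞 Val W := by
  obtain ⟨CV, hCV, hCVV, hVCV⟩ := htightV
  obtain ⟨CW, hCW, hCWW, hWCW⟩ := htightW
  rw [RTYield_eq_of_equiv htrans horder hCV hCVV hVCV,
    RTCost_eq_of_equiv htrans horder hCV hCVV hVCV,
    RTCost_eq_of_equiv htrans horder hCW hCWW hWCW]
  refine ⟨le_antisymm (csSup_le ⟨_, CV, hCV, rfl⟩ ?_) ?_, rfl⟩
  · rintro _ ⟨C, hC, rfl⟩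
    refine csSup_le (hbalne C hC) ?_
    rintro _ ⟨C', hC', hVW, rfl⟩
    have hvC := hVal_nonneg C hC
    have hvV := hVal_nonneg CV hCV
    obtain ⟨D, hD, hDval, hDV⟩ := (hfair CV hCV _ hΩC _ hΩS V hV
      (by simpa using hCVV)).2 C hC (by linarith)
    have hDW : arrow (Set.univ ∩ D) (W ∩ C') := htrans _ _ _ hDV hVW
    have hle : Val C' ≤ Val D := (horder D hD C' hC').2
      (htrans _ _ _ (by simpa using hDW) (hincl _ _ Set.inter_subset_right))
    obtain ⟨E, hE, hEval, hEW⟩ := (hfair D hD C' hC' _ hΩS W hW hDW).2 _ hΩC (by linarith)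
    have hWE : Val CW ≤ Val E := (horder E hE CW hCW).2
      (htrans _ _ _ (by simpa using hEW) hWCW)
    linarith
  · suffices h : ∃ C ∈ 𝒞, ∃ C' ∈ 𝒞, arrow (V ∩ C) (W ∩ C') ∧
        Val C' - Val C = Val CV - Val CW by
      obtain ⟨C, hC, C', hC', hVW, hval⟩ := h
      exact le_csSup_of_le hsupbdd ⟨C, hC, rfl⟩
        (le_csSup (hbalbdd C hC) ⟨C', hC', hVW, hval⟩)
    have hWfair := hfair CW hCW _ hΩC _ hΩS W hW (by simpa using hCWW)
    rcases lt_or_ge (Val CV) (Val CW) with hlt | hge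
    · obtain ⟨D, hD, hDval, hDV⟩ := (hfair _ hΩC CV hCV V hV _ hΩS
        (by simpa using hVCV)).2 CW hCW (by linarith)
      refine ⟨D, hD, _, hΩC, ?_, by linarith⟩
      simpa using htrans _ _ _ hDV (by simpa using hCWW)
    · rcases (hVal_nonneg CW hCW).eq_or_lt with h0 | hpos
      · obtain ⟨D, hD, hDval, hDW⟩ := hWfair.2 CV hCV (by linarith)
        have hCVD : arrow CV D := (horder CV hCV D hD).1 (by linarith)
        refine ⟨_, hΩC, CV, hCV, ?_, by linarith⟩
        simpa using htrans _ _ _ hVCV (htrans _ _ _ hCVD (by simpa using hDW))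
      · obtain ⟨D, hD, hDval, hDW⟩ := hWfair.1 CV hCV (by linarith)
          (lt_of_lt_of_le (EReal.coe_lt_coe_iff.2 (by linarith))
            (le_sSup ⟨CV, hCV, rfl⟩))
        refine ⟨_, hΩC, D, hD, ?_, by linarith⟩
        simpa using htrans _ _ _ hVCV (by simpa using hDW)
end

section
/- Let the Stage II resource theory have a relaxed currency (𝒞, Val, Ω) for a target 𝒮, independent of the target and good for the poor. Let V ∈ 𝒮 and C ∈ 𝒞 be such that the set {Val C' − Val C : C' ∈ 𝒞 ∧ V ∩ C → V ∩ C'} is nonempty and bounded above, the set {Val C : C ∈ 𝒞 ∧ V → C} is bounded above, and Balance(V→V|C) > 0. Then Yield(V) ≥ Balance(V→V|C) > 0 and Cost(V) = 0. -/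
/-- For a relaxed currency independent of the target and good for the
poor, a pathological resource with `Balance(V→V|C) > 0` satisfies
`Yield(V) ≥ Balance(V→V|C) > 0` and `Cost(V) = 0`. -/
theorem stmt14 {X : Type*} [Nonempty X] (arrow : Set X → Set X → Prop)
    (𝒞 𝒮 : Set (Set X)) (Val : Set X → ℝ)
    (hrefl : ∀ A, arrow A A)
    (htrans : ∀ A B C, arrow A B → arrow B C → arrow A C)
    (hincl : ∀ A B : Set X, A ⊆ B → arrow A B)
    (h𝒞ne : ∀ C ∈ 𝒞, C.Nonempty) (h𝒮ne : ∀ V ∈ 𝒮, V.Nonempty)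
    (hΩC : (Set.univ : Set X) ∈ 𝒞) (hΩS : (Set.univ : Set X) ∈ 𝒮)
    (hVal_nonneg : ∀ C ∈ 𝒞, 0 ≤ Val C) (hValΩ : Val (Set.univ : Set X) = 0)
    (horder : ∀ C ∈ 𝒞, ∀ C' ∈ 𝒞, Val C' ≤ Val C → arrow C C')
    (huniv : ∀ V ∈ 𝒮, (∃ C ∈ 𝒞, arrow C V) ∧ (∃ C' ∈ 𝒞, arrow V C'))
    (hcompat : ∀ C ∈ 𝒞, ∀ V ∈ 𝒮, (C ∩ V).Nonempty)
    (hindep : ∀ C ∈ 𝒞, ∀ C' ∈ 𝒞, ∀ V ∈ 𝒮, arrow C C' → arrow (C ∩ V) (C' ∩ V))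
    (hpoor : GoodForPoor arrow 𝒞 𝒮 Val)
    (V : Set X) (hV : V ∈ 𝒮) (C : Set X) (hC : C ∈ 𝒞)
    (hne : {x : ℝ | ∃ C' ∈ 𝒞, arrow (V ∩ C) (V ∩ C') ∧ Val C' - Val C = x}.Nonempty)
    (hbddB : BddAbove {x : ℝ | ∃ C' ∈ 𝒞, arrow (V ∩ C) (V ∩ C') ∧ Val C' - Val C = x})
    (hbddY : BddAbove {x : ℝ | ∃ C ∈ 𝒞, arrow V C ∧ Val C = x})
    (hpos : 0 < RTBalance arrow 𝒞 Val V V C) :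
    RTBalance arrow 𝒞 Val V V C ≤ RTYield arrow 𝒞 Val V ∧
      0 < RTBalance arrow 𝒞 Val V V C ∧ RTCost arrow 𝒞 Val V = 0 := by
  have hle_csup : ∀ A ∈ 𝒞, ((Val A : ℝ) : EReal) ≤ RTcsup 𝒞 Val := fun A hA =>
    le_sSup ⟨A, hA, rfl⟩
  have extract : ∀ C₂ ∈ 𝒞, arrow (V ∩ C) (V ∩ C₂) → 0 < Val C₂ - Val C →
      ∃ D ∈ 𝒞, Val D = Val C₂ - Val C ∧ arrow V (V ∩ D) := by
    intro C₂ hC₂ harr hΔ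
    rcases (hVal_nonneg C hC).eq_or_lt with h0 | h0
    · refine ⟨C₂, hC₂, by linarith, ?_⟩
      have h1 := hindep _ hΩC C hC V hV (horder _ hΩC C hC (by linarith))
      rw [Set.univ_inter, Set.inter_comm] at h1
      exact htrans _ _ _ h1 harr
    · obtain ⟨D, hD, hDv, hDa⟩ := (hpoor C hC C₂ hC₂ V hV V hV harr).1 Set.univ hΩC
        (by linarith) (by linarith)
        (lt_of_lt_of_le (EReal.coe_lt_coe_iff.2 (by linarith)) (hle_csup C₂ hC₂))
      rw [Set.inter_univ] at hDa
      exact ⟨D, hD, by linarith, hDa⟩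
  refine ⟨le_of_forall_lt fun b hb => ?_, hpos, ?_⟩
  · obtain ⟨x, ⟨C₂, hC₂, harr, rfl⟩, hx⟩ := exists_lt_of_lt_csSup hne (max_lt hb hpos)
    obtain ⟨hbx, hx0⟩ := max_lt_iff.1 hx
    obtain ⟨D, hD, hDv, hDa⟩ := extract C₂ hC₂ harr hx0
    exact hbx.trans_le (le_csSup hbddY
      ⟨D, hD, htrans _ _ _ hDa (hincl _ _ Set.inter_subset_right), hDv⟩)
  · obtain ⟨x, ⟨C₂, hC₂, harr, rfl⟩, hx⟩ := exists_lt_of_lt_csSup hne hpos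
    obtain ⟨E, hE, hEv, hEa⟩ := extract C₂ hC₂ harr hx
    rw [← hEv] at hx
    have hbelow : BddBelow {x : ℝ | ∃ C ∈ 𝒞, arrow C V ∧ Val C = x} :=
      ⟨0, by rintro _ ⟨A, hA, -, rfl⟩; exact hVal_nonneg A hA⟩
    have hcost_ne : {x : ℝ | ∃ C ∈ 𝒞, arrow C V ∧ Val C = x}.Nonempty := by
      obtain ⟨A, hA, hAV⟩ := (huniv V hV).1
      exact ⟨_, A, hA, hAV, rfl⟩
    have hcost_nonneg : 0 ≤ RTCost arrow 𝒞 Val V :=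
      le_csInf hcost_ne (by rintro _ ⟨A, hA, -, rfl⟩; exact hVal_nonneg A hA)
    have hcost_le : ∀ A ∈ 𝒞, arrow A V → RTCost arrow 𝒞 Val V ≤ Val A := fun A hA hAV =>
      csInf_le hbelow ⟨A, hA, hAV, rfl⟩
    obtain ⟨_, ⟨D, hD, hDV, rfl⟩, hlt⟩ := exists_lt_of_csInf_lt hcost_ne
      (show RTCost arrow 𝒞 Val V < RTCost arrow 𝒞 Val V + Val E by linarith)
    have hDE : arrow (Set.univ ∩ D) (V ∩ E) := by
      rw [Set.univ_inter]
      exact htrans _ _ _ hDV hEa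
    have hgain := hpoor D hD E hE _ hΩS V hV hDE
    rcases le_or_gt (Val E) (Val D) with hED | hED
    · obtain ⟨A, hA, hAv, hAa⟩ := hgain.2 Set.univ hΩC (by linarith) (by linarith)
      rw [Set.univ_inter, Set.inter_univ] at hAa
      linarith [hcost_le A hA hAa]
    · rcases (hVal_nonneg D hD).eq_or_lt with h0 | h0
      · linarith [hcost_le D hD hDV]
      · obtain ⟨A, -, -, hAa⟩ := hgain.1 Set.univ hΩC (by linarith) (by linarith)
          (lt_of_lt_of_le (EReal.coe_lt_coe_iff.2 (by linarith)) (hle_csup E hE))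
        rw [Set.univ_inter] at hAa
        have := hcost_le _ hΩC (htrans _ _ _ hAa (hincl _ _ Set.inter_subset_left))
        linarith
end

section
/- Let the Stage II resource theory have a relaxed currency (𝒞, Val, Ω) for a target 𝒮, independent of the target and good for the rich, and suppose the set {Val C : C ∈ 𝒞} is not bounded above (c_sup = ∞). If V ∈ 𝒮 and C, C₂ ∈ 𝒞 satisfy V ∩ C → V ∩ C₂ and Val C₂ > Val C, then the set {Val C' − Val C : C' ∈ 𝒞 ∧ V ∩ C → V ∩ C'} is not bounded above; equivalently, for every M ∈ ℝ there exists C' ∈ 𝒞 with V ∩ C → V ∩ C' and Val C' − Val C ≥ M. -/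
/-- For a relaxed currency independent of the target and good for the
rich, with unbounded currency values (`c_sup = ∞`): if `V ∩ C → V ∩ C₂` with
`Val C₂ > Val C`, then the balance set is unbounded above — arbitrarily large amounts of
currency can be generated. -/
theorem stmt16 {X : Type*} [Nonempty X] (arrow : Set X → Set X → Prop)
    (𝒞 𝒮 : Set (Set X)) (Val : Set X → ℝ)
    (hrefl : ∀ A, arrow A A)
    (htrans : ∀ A B C, arrow A B → arrow B C → arrow A C)
    (hincl : ∀ A B : Set X, A ⊆ B → arrow A B)
    (h𝒞ne : ∀ C ∈ 𝒞, C.Nonempty) (h𝒮ne : ∀ V ∈ 𝒮, V.Nonempty)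
    (hΩC : (Set.univ : Set X) ∈ 𝒞) (hΩS : (Set.univ : Set X) ∈ 𝒮)
    (hVal_nonneg : ∀ C ∈ 𝒞, 0 ≤ Val C) (hValΩ : Val (Set.univ : Set X) = 0)
    (horder : ∀ C ∈ 𝒞, ∀ C' ∈ 𝒞, Val C' ≤ Val C → arrow C C')
    (huniv : ∀ V ∈ 𝒮, (∃ C ∈ 𝒞, arrow C V) ∧ (∃ C' ∈ 𝒞, arrow V C'))
    (hcompat : ∀ C ∈ 𝒞, ∀ V ∈ 𝒮, (C ∩ V).Nonempty)
    (hindep : ∀ C ∈ 𝒞, ∀ C' ∈ 𝒞, ∀ V ∈ 𝒮, arrow C C' → arrow (C ∩ V) (C' ∩ V))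
    (hrich : GoodForRich arrow 𝒞 𝒮 Val)
    (hub : ¬ BddAbove {x : ℝ | ∃ C ∈ 𝒞, Val C = x})
    (V : Set X) (hV : V ∈ 𝒮)
    (C C₂ : Set X) (hC : C ∈ 𝒞) (hC₂ : C₂ ∈ 𝒞)
    (harr : arrow (V ∩ C) (V ∩ C₂)) (hval : Val C < Val C₂) :
    ¬ BddAbove {x : ℝ | ∃ C' ∈ 𝒞, arrow (V ∩ C) (V ∩ C') ∧ Val C' - Val C = x} ∧
      ∀ M : ℝ, ∃ C' ∈ 𝒞, arrow (V ∩ C) (V ∩ C') ∧ M ≤ Val C' - Val C := by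
  have hcsup : RTcsup 𝒞 Val = ⊤ := by
    refine sSup_eq_top.2 fun b hb => ?_
    obtain ⟨r, hbr, -⟩ := EReal.lt_iff_exists_real_btwn.1 hb
    obtain ⟨x, ⟨D, hD, rfl⟩, hx⟩ := not_bddAbove_iff.1 hub r
    exact ⟨_, ⟨D, hD, rfl⟩, hbr.trans (EReal.coe_lt_coe_iff.2 hx)⟩
  have hΔ : 0 < Val C₂ - Val C := sub_pos.2 hval
  have iter : ∀ n : ℕ, ∃ C' ∈ 𝒞, Val C' = Val C + n * (Val C₂ - Val C) ∧
      arrow (V ∩ C) (V ∩ C') := by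
    intro n
    induction n with
    | zero => exact ⟨C, hC, by simp, hrefl _⟩
    | succ n ih =>
      obtain ⟨D, hD, hDval, hCD⟩ := ih
      have hn : 0 ≤ (n : ℝ) * (Val C₂ - Val C) := by positivity
      obtain ⟨E, hE, hEval, hDE⟩ := (hrich C hC C₂ hC₂ V hV V hV harr).1 D hD
        (by linarith) (by linarith [hVal_nonneg D hD]) (hcsup ▸ EReal.coe_lt_top _)
      exact ⟨E, hE, by rw [hEval, hDval]; push_cast; ring, htrans _ _ _ hCD hDE⟩
  have large : ∀ M : ℝ, ∃ C' ∈ 𝒞, arrow (V ∩ C) (V ∩ C') ∧ M ≤ Val C' - Val C := by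
    intro M
    obtain ⟨n, hn⟩ := Archimedean.arch M hΔ
    obtain ⟨D, hD, hDval, hCD⟩ := iter n
    rw [nsmul_eq_mul] at hn
    exact ⟨D, hD, hCD, by linarith⟩
  refine ⟨?_, large⟩
  rintro ⟨B, hB⟩
  obtain ⟨D, hD, hCD, hle⟩ := large (B + 1)
  linarith [hB ⟨D, hD, hCD, rfl⟩]
end
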